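/- Let f : ℝ^{n_x} → ℝ^{n_x} be a bijection with f⁻¹ globally Lipschitz with constant c_f > 0, let φ : ℝ^{n_x} → ℝ be globally Lipschitz with constant c_h > 0, let Ã ∈ ℝ^{m×m}, B̃ ∈ ℝ^m, and let γ > 0 satisfy γ‖Ã‖c_f < 1. Then for all x_a, x_b ∈ ℝ^{n_x}, the tail series Σ_{j=m}^{∞} (γÃ)ʲ B̃ (φ((f⁻¹)^{∘(j+1)}(x_a)) − φ((f⁻¹)^{∘(j+1)}(x_b))) converges absolutely and its norm is bounded by ‖B̃‖ · c_h · c_f · (γ‖Ã‖c_f)^m / (1 − γ‖Ã‖c_f) · ‖x_a − x_b‖. -/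

import Mathlib

open Matrix

attribute [local instance] Matrix.linftyOpNormedAddCommGroup

/-- Iterates of a map that is Lipschitz with constant `c` are Lipschitz with constant `c ^ k`. -/
theorem norm_iterate_sub_iterate_le {E : Type*} [SeminormedAddCommGroup E] {g : E → E} {c : ℝ}
    (hc : 0 ≤ c) (hg : ∀ x y, ‖g x - g y‖ ≤ c * ‖x - y‖) (k : ℕ) (x y : E) :
    ‖g^[k] x - g^[k] y‖ ≤ c ^ k * ‖x - y‖ := by
  induction k with
  | zero => simp
  | succ k ih =>
    rw [Function.iterate_succ_apply', Function.iterate_succ_apply', pow_succ', mul_assoc]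
    exact (hg _ _).trans (mul_le_mul_of_nonneg_left ih hc)

theorem norm_pow_mulVec_le {n : Type*} [Fintype n] [DecidableEq n] (A : Matrix n n ℝ) (v : n → ℝ)
    (k : ℕ) : ‖(A ^ k) *ᵥ v‖ ≤ ‖A‖ ^ k * ‖v‖ := by
  induction k with
  | zero => simp
  | succ k ih =>
    rw [pow_succ', pow_succ', ← Matrix.mulVec_mulVec, mul_assoc]
    exact (Matrix.linfty_opNorm_mulVec _ _).trans (mul_le_mul_of_nonneg_left ih (norm_nonneg _))

/-- the tail series
`Σ_{j=m}^∞ (γÃ)ʲ B̃ (φ((f⁻¹)^{∘(j+1)}(x_a)) − φ((f⁻¹)^{∘(j+1)}(x_b)))`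
converges absolutely and its norm is bounded by
`‖B̃‖ c_h c_f (γ‖Ã‖c_f)^m / (1 − γ‖Ã‖c_f) ‖x_a − x_b‖`.  Here `g` plays the role of
`f⁻¹`, and the tail is written as a sum over `j : ℕ` of the terms of index `m + j`. -/
theorem stmt6 {nx m : ℕ}
    (f g : (Fin nx → ℝ) → (Fin nx → ℝ))
    (hfg : Function.LeftInverse g f) (hgf : Function.RightInverse g f)
    (φ : (Fin nx → ℝ) → ℝ)
    (cf ch γ : ℝ) (hcf : 0 < cf) (hch : 0 < ch) (hγ : 0 < γ)
    (hg : ∀ xa xb, ‖g xa - g xb‖ ≤ cf * ‖xa - xb‖)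
    (hφ : ∀ xa xb, |φ xa - φ xb| ≤ ch * ‖xa - xb‖)
    (At : Matrix (Fin m) (Fin m) ℝ) (Bt : Fin m → ℝ)
    (hsmall : γ * ‖At‖ * cf < 1) :
    ∀ xa xb : Fin nx → ℝ,
      (Summable fun j : ℕ =>
        ‖(φ (g^[m + j + 1] xa) - φ (g^[m + j + 1] xb)) • (((γ • At) ^ (m + j)) *ᵥ Bt)‖) ∧
      ‖∑' j : ℕ, (φ (g^[m + j + 1] xa) - φ (g^[m + j + 1] xb)) • (((γ • At) ^ (m + j)) *ᵥ Bt)‖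
        ≤ ‖Bt‖ * ch * cf * (γ * ‖At‖ * cf) ^ m / (1 - γ * ‖At‖ * cf) * ‖xa - xb‖ := by
  intro xa xb
  have hnorm : ‖γ • At‖ = γ * ‖At‖ := by
    let := Matrix.linftyOpNormedSpace (R := ℝ) (α := ℝ) (m := Fin m) (n := Fin m)
    rw [norm_smul, Real.norm_of_nonneg hγ.le]
  set q := γ * ‖At‖ * cf with hq
  have hq0 : 0 ≤ q := by positivity
  have hbound : ∀ j : ℕ,
      ‖(φ (g^[m + j + 1] xa) - φ (g^[m + j + 1] xb)) • (((γ • At) ^ (m + j)) *ᵥ Bt)‖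
        ≤ ‖Bt‖ * ch * cf * q ^ m * ‖xa - xb‖ * q ^ j := by
    intro j
    have hφj : |φ (g^[m + j + 1] xa) - φ (g^[m + j + 1] xb)|
        ≤ ch * (cf ^ (m + j + 1) * ‖xa - xb‖) :=
      (hφ _ _).trans (mul_le_mul_of_nonneg_left
        (norm_iterate_sub_iterate_le hcf.le hg _ _ _) hch.le)
    have hA := norm_pow_mulVec_le (γ • At) Bt (m + j)
    rw [hnorm] at hA
    rw [norm_smul, Real.norm_eq_abs]
    calc _ ≤ ch * (cf ^ (m + j + 1) * ‖xa - xb‖) * ((γ * ‖At‖) ^ (m + j) * ‖Bt‖) :=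
          mul_le_mul hφj hA (norm_nonneg _) (by positivity)
      _ = _ := by rw [hq]; ring
  have hsum := (hasSum_geometric_of_lt_one hq0 hsmall).mul_left
    (‖Bt‖ * ch * cf * q ^ m * ‖xa - xb‖)
  refine ⟨hsum.summable.of_nonneg_of_le (fun _ => norm_nonneg _) hbound, ?_⟩
  refine (tsum_of_norm_bounded hsum hbound).trans_eq ?_
  ring
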